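/- (Correctness of pruning Strategy 2) Let X be an itemset in a database D, let m be a positive integer with m ≤ sup(X), and let β ∈ ℝ. If Top_m(T ↦ uo(X,T) + ruo(X,T), Γ_X) / m < β, then every ≺-extension W of X with sup(W) ≥ m satisfies uo(W) < β; i.e., no pattern in the subtree rooted at X that meets the minimum support m is a high utility occupancy pattern for threshold β. -/

import Mathlib

open Finset

/-- Transaction utility: total utility of all items in transaction `T`. -/
noncomputable def tu {ι τ : Type*} (items : τ → Finset ι) (u : ι → τ → ℝ) (T : τ) : ℝ :=
  ∑ i ∈ items T, u i T

/-- Utility occupancy of an itemset `X` in a transaction `T`. -/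
noncomputable def uo {ι τ : Type*} (items : τ → Finset ι) (u : ι → τ → ℝ)
    (X : Finset ι) (T : τ) : ℝ :=
  (∑ i ∈ X, u i T) / tu items u T

/-- Remaining utility occupancy of an itemset `X` in a transaction `T`. -/
noncomputable def ruo {ι τ : Type*} [LinearOrder ι] (items : τ → Finset ι) (u : ι → τ → ℝ)
    (X : Finset ι) (T : τ) : ℝ :=
  (∑ i ∈ (items T).filter (fun j => ∀ x ∈ X, x < j), u i T) / tu items u T

/-- Supporting transactions of itemset `X` in database `D`. -/
def supTrans {ι τ : Type*} [DecidableEq ι] (items : τ → Finset ι) (D : Finset τ)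
    (X : Finset ι) : Finset τ :=
  D.filter (fun T => X ⊆ items T)

/-- Utility occupancy of an itemset `X` in a database `D`. -/
noncomputable def uoDB {ι τ : Type*} [DecidableEq ι] (items : τ → Finset ι) (u : ι → τ → ℝ)
    (D : Finset τ) (X : Finset ι) : ℝ :=
  (∑ T ∈ supTrans items D X, uo items u X T) / (supTrans items D X).card

/-- `W` is an `≺`-extension of `X`. -/
def IsExtension {ι : Type*} [LinearOrder ι] (X W : Finset ι) : Prop :=
  X ⊆ W ∧ ∀ x ∈ X, ∀ w ∈ W \ X, x < w

/-- `topSum k v S`: the maximum of `Σ_{s ∈ A} v s` over all `k`-element subsets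
`A ⊆ S` (the sum of the `k` largest values of `v` on `S`). -/
noncomputable def topSum {α : Type*} (k : ℕ) (v : α → ℝ) (S : Finset α) : ℝ :=
  sSup ((fun A : Finset α => ∑ s ∈ A, v s) '' {A : Finset α | A ⊆ S ∧ A.card = k})

/-- If every `m`-element subset of `S` has `v`-sum at most `t`, then the average of `v` over `S`
is at most `t / m`. -/
theorem mul_sum_le_card_mul_of_forall_card_eq {α : Type*} {m : ℕ} (hm : 1 ≤ m) {v : α → ℝ}
    {t : ℝ} {S : Finset α} (hS : m ≤ S.card)
    (h : ∀ A ⊆ S, A.card = m → ∑ a ∈ A, v a ≤ t) :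
    m * ∑ a ∈ S, v a ≤ S.card * t := by
  classical
  obtain ⟨n, hn⟩ : ∃ n, S.card = n := ⟨_, rfl⟩
  rw [hn] at hS ⊢
  induction n, hS using Nat.le_induction generalizing S with
  | base => exact mul_le_mul_of_nonneg_left (h S Subset.rfl hn) (Nat.cast_nonneg m)
  | succ n hmn ih =>
    have erase_le : ∀ s ∈ S, m * (∑ a ∈ S, v a - v s) ≤ n * t := fun s hs => by
      rw [← sum_erase_eq_sub hs]
      exact ih (fun A hA => h A (hA.trans (erase_subset s S)))
        (by rw [card_erase_of_mem hs, hn]; rfl)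
    have sum_le := sum_le_sum erase_le
    rw [← mul_sum, sum_sub_distrib, sum_const, sum_const, hn, nsmul_eq_mul, nsmul_eq_mul] at sum_le
    have n_pos : (0 : ℝ) < n := by exact_mod_cast hm.trans hmn
    push_cast at sum_le ⊢
    refine le_of_mul_le_mul_left ?_ n_pos
    linarith

theorem sum_le_topSum {α : Type*} {k : ℕ} {v : α → ℝ} {S A : Finset α} (hA : A ⊆ S)
    (hk : A.card = k) : ∑ a ∈ A, v a ≤ topSum k v S := by
  refine le_csSup (Set.Finite.bddAbove (Set.Finite.image _ ?_)) ⟨A, ⟨hA, hk⟩, rfl⟩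
  exact S.powerset.finite_toSet.subset fun B hB => mem_coe.2 (mem_powerset.2 hB.1)

/-- The utility occupancy of an extension of `X` is bounded by the utility occupancy of `X` plus
its remaining utility occupancy. -/
theorem IsExtension.uo_le_uo_add_ruo {ι τ : Type*} [LinearOrder ι] {items : τ → Finset ι}
    {u : ι → τ → ℝ} {X W : Finset ι} {T : τ} (hXW : IsExtension X W) (hW : W ⊆ items T)
    (hu : ∀ j ∈ items T, 0 ≤ u j T) :
    uo items u W T ≤ uo items u X T + ruo items u X T := by
  unfold uo ruo
  rw [← add_div]
  refine div_le_div_of_nonneg_right ?_ (sum_nonneg hu)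
  rw [← sum_sdiff hXW.1, add_comm]
  refine add_le_add_right ?_ _
  refine sum_le_sum_of_subset_of_nonneg (fun w hw => ?_) fun j hj _ => ?_
  · exact mem_filter.2 ⟨hW (mem_sdiff.1 hw).1, fun x hx => hXW.2 x hx w hw⟩
  · exact hu j (mem_filter.1 hj).1

/-- Correctness of pruning Strategy 2: if the utility-occupancy upper bound at `X`
is below `β`, then no sufficiently supported `≺`-extension of `X` is a HUOP. -/
theorem pruning_strategy2 {ι τ : Type*} [LinearOrder ι]
    (items : τ → Finset ι) (u : ι → τ → ℝ) (D : Finset τ)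
    (hu : ∀ T ∈ D, ∀ j ∈ items T, 0 ≤ u j T) (htu : ∀ T ∈ D, 0 < tu items u T)
    (X : Finset ι) (m : ℕ) (hm1 : 1 ≤ m) (hm2 : m ≤ (supTrans items D X).card)
    (β : ℝ)
    (hbound : topSum m (fun T => uo items u X T + ruo items u X T)
        (supTrans items D X) / m < β) :
    ∀ W : Finset ι, IsExtension X W → m ≤ (supTrans items D W).card →
      uoDB items u D W < β := by
  intro W hXW hmW
  have subset : supTrans items D W ⊆ supTrans items D X :=
    monotone_filter_right D fun _ _ hT => hXW.1.trans hT
  have average_le := mul_sum_le_card_mul_of_forall_card_eq hm1 hmW fun A hA hk =>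
    sum_le_topSum (v := fun T => uo items u X T + ruo items u X T) (hA.trans subset) hk
  have sum_le : ∑ T ∈ supTrans items D W, uo items u W T ≤
      ∑ T ∈ supTrans items D W, (uo items u X T + ruo items u X T) :=
    sum_le_sum fun T hT =>
      hXW.uo_le_uo_add_ruo (mem_filter.1 hT).2 (hu T (mem_filter.1 hT).1)
  have m_pos : (0 : ℝ) < m := by exact_mod_cast hm1
  have card_pos : (0 : ℝ) < (supTrans items D W).card := by exact_mod_cast hm1.trans hmW
  refine lt_of_le_of_lt ?_ hbound
  rw [uoDB, div_le_div_iff₀ card_pos m_pos]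
  linarith [mul_le_mul_of_nonneg_left sum_le m_pos.le]
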